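/- Let X, Y be real Hilbert spaces, A, V : X → Y bounded linear operators with ‖A − V‖ > 0 and ‖V‖ > 0, and let ε > 0, 0 < δ ≤ κ < 1, μ_G > 0, μ_F > 0, γ_G, γ_F > 0. Define the constant stepsizes τ = min{δ/(ε‖A − V‖), √((1 − κ)μ_F/(‖V‖² μ_G))}, σ = (μ_G/μ_F)τ, and ω = 1/(1 + 2τμ_G), and assume γ_G ≥ (ε/(2ω))‖A − V‖ + μ_G and γ_F ≥ ((1 + ω)/(2ε))‖A − V‖ + μ_F. Let G : X → ℝ be γ_G-strongly convex and F* : Y → ℝ be γ_F-strongly convex, let (x^i) ⊂ X, (y^i) ⊂ Y satisfy: for every i, (1/τ)(x^i − x^{i+1}) − V*y^i is a subgradient of G at x^{i+1} and (1/σ)(y^i − y^{i+1}) + A(x^{i+1} + ω(x^{i+1} − x^i)) is a subgradient of F* at y^{i+1}, and let (x̂, ŷ) satisfy: −V*ŷ is a subgradient of G at x̂ and A x̂ is a subgradient of F* at ŷ. Then there exists C ≥ 0 such that for all N ∈ ℕ: ‖x^N − x̂‖² + ‖y^N − ŷ‖² ≤ C ω^N. -/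

import Mathlib

open scoped RealInnerProductSpace

/-- `g` is a subgradient of `f : E → ℝ` at `x`. -/
def HasSubgradientAt {E : Type*} [NormedAddCommGroup E] [InnerProductSpace ℝ E]
    (f : E → ℝ) (g x : E) : Prop :=
  ∀ u, f x + ⟪g, u - x⟫ ≤ f u

/-- `f` is `γ`-strongly convex: `u ↦ f u - γ/2 * ‖u‖²` is convex. -/
def StronglyConvexWith {E : Type*} [NormedAddCommGroup E] [InnerProductSpace ℝ E]
    (γ : ℝ) (f : E → ℝ) : Prop :=
  ConvexOn ℝ Set.univ (fun u => f u - γ / 2 * ‖u‖ ^ 2)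

set_option maxHeartbeats 1000000

theorem strong_subgrad {E : Type*} [NormedAddCommGroup E] [InnerProductSpace ℝ E]
    {γ : ℝ} {f : E → ℝ} (hf : StronglyConvexWith γ f) {g x : E} (hg : HasSubgradientAt f g x)
    (z : E) : f x + ⟪g, z - x⟫ + γ / 2 * ‖x - z‖ ^ 2 ≤ f z := by
  have hs : StrongConvexOn Set.univ γ f := strongConvexOn_iff_convex.2 hf
  have key : ∀ t : ℝ, 0 < t → t < 1 →
      f x + ⟪g, z - x⟫ + γ / 2 * ‖x - z‖ ^ 2 - f z ≤ t * (γ / 2 * ‖x - z‖ ^ 2) := by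
    intro t ht0 ht1
    have h1 := hs.2 (Set.mem_univ x) (Set.mem_univ z) (sub_nonneg.2 ht1.le) ht0.le
      (by ring : (1 - t) + t = 1)
    have h2 := hg ((1 - t) • x + t • z)
    have h3 : (1 - t) • x + t • z - x = t • (z - x) := by module
    rw [h3, inner_smul_right] at h2
    simp only [smul_eq_mul] at h1
    have h4 : t * (f x + ⟪g, z - x⟫ + γ / 2 * ‖x - z‖ ^ 2 - f z)
        ≤ t * (t * (γ / 2 * ‖x - z‖ ^ 2)) := by linarith
    exact le_of_mul_le_mul_left h4 ht0
  have hlim : Filter.Tendsto (fun t : ℝ => t * (γ / 2 * ‖x - z‖ ^ 2)) (nhdsWithin 0 (Set.Ioi 0))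
      (nhds 0) := by
    have : Filter.Tendsto (fun t : ℝ => t * (γ / 2 * ‖x - z‖ ^ 2)) (nhds 0)
      (nhds (0 * (γ / 2 * ‖x - z‖ ^ 2))) := by
      apply Continuous.tendsto
      fun_prop
    rw [zero_mul] at this
    exact this.mono_left nhdsWithin_le_nhds
  have hev : ∀ᶠ t : ℝ in nhdsWithin 0 (Set.Ioi 0),
      f x + ⟪g, z - x⟫ + γ / 2 * ‖x - z‖ ^ 2 - f z ≤ t * (γ / 2 * ‖x - z‖ ^ 2) := by
    filter_upwards [Ioo_mem_nhdsGT (zero_lt_one' ℝ)] with t ht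
    exact key t ht.1 ht.2
  have := ge_of_tendsto hlim hev
  linarith

theorem strong_mono {E : Type*} [NormedAddCommGroup E] [InnerProductSpace ℝ E]
    {γ : ℝ} {f : E → ℝ} (hf : StronglyConvexWith γ f) {g h x z : E}
    (hg : HasSubgradientAt f g x) (hh : HasSubgradientAt f h z) :
    γ * ‖x - z‖ ^ 2 ≤ ⟪g - h, x - z⟫ := by
  have h1 := strong_subgrad hf hg z
  have h2 := strong_subgrad hf hh x
  rw [← neg_sub x z, inner_neg_right] at h1
  rw [norm_sub_rev z x] at h2
  rw [inner_sub_left]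
  linarith

theorem young_aux {L θ s t p q : ℝ} (hθ : 0 ≤ θ) (hs : 0 < s) (ht : 0 < t)
    (hp : 0 ≤ p) (hq : 0 ≤ q) (h : L ^ 2 ≤ θ ^ 2 * (s * t)) :
    L * p * q ≤ θ / 2 * (s * p ^ 2 + t * q ^ 2) := by
  have hR : 0 ≤ θ / 2 * (s * p ^ 2 + t * q ^ 2) := by positivity
  apply le_of_sq_le_sq _ hR
  have h1 : L ^ 2 * (p * q) ^ 2 ≤ θ ^ 2 * (s * t) * (p * q) ^ 2 :=
    mul_le_mul_of_nonneg_right h (by positivity)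
  have h2 : 0 ≤ θ ^ 2 * (s * p ^ 2 - t * q ^ 2) ^ 2 := by positivity
  nlinarith

theorem inner_bound {X Y : Type*}
    [NormedAddCommGroup X] [InnerProductSpace ℝ X] [NormedAddCommGroup Y] [InnerProductSpace ℝ Y]
    (V : X →L[ℝ] Y) {θ s t : ℝ} (hθ : 0 ≤ θ) (hs : 0 < s) (ht : 0 < t)
    (h : ‖V‖ ^ 2 ≤ θ ^ 2 * (s * t)) (a : X) (b : Y) :
    ⟪V a, b⟫ ≤ θ / 2 * (s * ‖a‖ ^ 2 + t * ‖b‖ ^ 2) := by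
  calc ⟪V a, b⟫ ≤ ‖V a‖ * ‖b‖ := real_inner_le_norm _ _
    _ ≤ ‖V‖ * ‖a‖ * ‖b‖ := by gcongr; exact V.le_opNorm a
    _ ≤ _ := young_aux hθ hs ht (norm_nonneg _) (norm_nonneg _) h

theorem three_point {E : Type*} [NormedAddCommGroup E] [InnerProductSpace ℝ E] (a a' : E) :
    ⟪a - a', a'⟫ = (‖a‖ ^ 2 - ‖a'‖ ^ 2 - ‖a' - a‖ ^ 2) / 2 := by
  rw [norm_sub_sq_real, inner_sub_left, real_inner_self_eq_norm_sq, real_inner_comm]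
  ring

theorem statement8 {X Y : Type*}
    [NormedAddCommGroup X] [InnerProductSpace ℝ X] [CompleteSpace X]
    [NormedAddCommGroup Y] [InnerProductSpace ℝ Y] [CompleteSpace Y]
    (A V : X →L[ℝ] Y) (hAV : 0 < ‖A - V‖) (hV : 0 < ‖V‖)
    (ε δ κ μG μF γG γF τ σ ω : ℝ)
    (hε : 0 < ε) (hδ : 0 < δ) (hδκ : δ ≤ κ) (hκ : κ < 1)
    (hμG : 0 < μG) (hμF : 0 < μF) (hγG : 0 < γG) (hγF : 0 < γF)
    (hτ : τ = min (δ / (ε * ‖A - V‖)) (Real.sqrt ((1 - κ) * μF / (‖V‖ ^ 2 * μG))))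
    (hσ : σ = μG / μF * τ)
    (hω : ω = 1 / (1 + 2 * τ * μG))
    (hγGbound : γG ≥ ε / (2 * ω) * ‖A - V‖ + μG)
    (hγFbound : γF ≥ (1 + ω) / (2 * ε) * ‖A - V‖ + μF)
    (G : X → ℝ) (Fstar : Y → ℝ)
    (hG : StronglyConvexWith γG G)
    (hFstar : StronglyConvexWith γF Fstar)
    (x : ℕ → X) (y : ℕ → Y)
    (hx : ∀ i, HasSubgradientAt G
      ((1 / τ) • (x i - x (i + 1)) - ContinuousLinearMap.adjoint V (y i)) (x (i + 1)))
    (hy : ∀ i, HasSubgradientAt Fstar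
      ((1 / σ) • (y i - y (i + 1)) + A (x (i + 1) + ω • (x (i + 1) - x i))) (y (i + 1)))
    (xh : X) (yh : Y)
    (hxh : HasSubgradientAt G (-(ContinuousLinearMap.adjoint V yh)) xh)
    (hyh : HasSubgradientAt Fstar (A xh) yh) :
    ∃ C : ℝ, 0 ≤ C ∧ ∀ N : ℕ, ‖x N - xh‖ ^ 2 + ‖y N - yh‖ ^ 2 ≤ C * ω ^ N := by
  set M := ‖A - V‖ with hM
  have h1κ : 0 < 1 - κ := by linarith
  have hτ0 : 0 < τ := by
    rw [hτ]; apply lt_min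
    · positivity
    · apply Real.sqrt_pos.2; positivity
  have hτ1 : τ * (ε * M) ≤ δ := by
    have : τ ≤ δ / (ε * M) := hτ ▸ min_le_left _ _
    rwa [le_div_iff₀ (by positivity)] at this
  have hτ2 : τ ^ 2 * (‖V‖ ^ 2 * μG) ≤ (1 - κ) * μF := by
    have h : τ ≤ Real.sqrt ((1 - κ) * μF / (‖V‖ ^ 2 * μG)) := hτ ▸ min_le_right _ _
    rw [Real.le_sqrt hτ0.le (by positivity)] at h
    rwa [le_div_iff₀ (by positivity)] at h
  clear hτ
  have hσ0 : 0 < σ := by rw [hσ]; positivity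
  have hσμ : σ * μF = τ * μG := by rw [hσ]; field_simp
  have hω0 : 0 < ω := by rw [hω]; positivity
  have hω1 : ω ≤ 1 := by
    rw [hω]; apply div_le_one_of_le₀ <;> nlinarith [mul_pos hτ0 hμG]
  have hωi : 1 / ω = 1 + 2 * τ * μG := by rw [hω]; simp
  have hLts : ‖V‖ ^ 2 * (τ * σ) ≤ 1 - κ := by
    have : ‖V‖ ^ 2 * (τ * σ) * μF ≤ (1 - κ) * μF := by
      calc ‖V‖ ^ 2 * (τ * σ) * μF = ‖V‖ ^ 2 * τ * (σ * μF) := by ring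
        _ = τ ^ 2 * (‖V‖ ^ 2 * μG) := by rw [hσμ]; ring
        _ ≤ _ := hτ2
    exact le_of_mul_le_mul_right this hμF
  have hLtsω : ‖V‖ ^ 2 * (τ * (σ * ω)) ≤ 1 - κ := by
    refine le_trans ?_ hLts
    gcongr
    nlinarith
  -- step-size weights
  obtain ⟨s, hs⟩ : ∃ s, s = 1 / τ := ⟨_, rfl⟩
  obtain ⟨t, ht⟩ : ∃ t, t = 1 / (σ * ω) := ⟨_, rfl⟩
  have hs0 : 0 < s := by rw [hs]; positivity
  have ht0 : 0 < t := by rw [ht]; positivity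
  have hLst : ‖V‖ ^ 2 ≤ (1 - κ) * (s * t) := by
    have : (1 - κ) * (s * t) = (1 - κ) / (τ * (σ * ω)) := by rw [hs, ht]; field_simp
    rw [this, le_div_iff₀ (by positivity)]
    exact hLtsω
  set θ := Real.sqrt (1 - κ) with hθ
  have hθ0 : 0 ≤ θ := Real.sqrt_nonneg _
  have hθ2 : θ ^ 2 = 1 - κ := Real.sq_sqrt h1κ.le
  have hθ1 : θ < 1 := by nlinarith
  have hLow : ∀ (a : X) (b : Y), ⟪V a, b⟫ ≤ θ / 2 * (s * ‖a‖ ^ 2 + t * ‖b‖ ^ 2) :=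
    inner_bound V hθ0 hs0 ht0 (by rw [hθ2]; exact hLst)
  have hs' : 1 - κ ≤ (s - ε * M) / s := by
    rw [hs]
    have : (1 / τ - ε * M) / (1 / τ) = 1 - τ * (ε * M) := by field_simp
    rw [this]; linarith
  have hsκ : (1 - κ) * s ≤ s - ε * M := by rwa [le_div_iff₀ hs0] at hs'
  have hsM : 0 < s - ε * M := lt_of_lt_of_le (by positivity) hsκ
  have hStep : ∀ (a : X) (b : Y), ⟪V a, b⟫ ≤ 1 / 2 * ((s - ε * M) * ‖a‖ ^ 2 + t * ‖b‖ ^ 2) :=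
    inner_bound V zero_le_one hsM ht0 (by
      rw [one_pow, one_mul]
      calc _ ≤ _ := hLst
        _ = ((1 - κ) * s) * t := by ring
        _ ≤ _ := by gcongr)
  have hD : ∀ (a : X) (b : Y), ⟪(A - V) a, b⟫ ≤ 1 / 2 * ((M * ε) * ‖a‖ ^ 2 + (M / ε) * ‖b‖ ^ 2) :=
    inner_bound (A - V) zero_le_one (by positivity) (by positivity) (by
      rw [← hM]; apply le_of_eq; field_simp)
  obtain ⟨P, hP⟩ : ∃ P : ℕ → ℝ, ∀ i, P i =
    s / 2 * ‖x i - xh‖ ^ 2 + t / 2 * ‖y i - yh‖ ^ 2 - ⟪V (x i - xh), y i - yh⟫ := ⟨_, fun _ => rfl⟩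
  have hPlow : ∀ i, (1 - θ) / 2 * min s t * (‖x i - xh‖ ^ 2 + ‖y i - yh‖ ^ 2) ≤ P i := by
    intro i
    rw [hP]
    have h1 := hLow (x i - xh) (y i - yh)
    have h2 : min s t * ‖x i - xh‖ ^ 2 ≤ s * ‖x i - xh‖ ^ 2 := by gcongr; exact min_le_left _ _
    have h3 : min s t * ‖y i - yh‖ ^ 2 ≤ t * ‖y i - yh‖ ^ 2 := by gcongr; exact min_le_right _ _
    have h4 := mul_le_mul_of_nonneg_left (add_le_add h2 h3) (by linarith : 0 ≤ (1 - θ) / 2)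
    linarith
  have hrec : ∀ i, P (i + 1) ≤ ω * P i := by
    intro i
    have e1 := strong_mono hG (hx i) hxh
    have e2 := strong_mono hFstar (hy i) hyh
    rw [hP, hP]
    obtain ⟨a, ha⟩ : ∃ a, a = x i - xh := ⟨_, rfl⟩
    obtain ⟨a', ha'⟩ : ∃ a', a' = x (i + 1) - xh := ⟨_, rfl⟩
    obtain ⟨b, hb⟩ : ∃ b, b = y i - yh := ⟨_, rfl⟩
    obtain ⟨b', hb'⟩ : ∃ b', b' = y (i + 1) - yh := ⟨_, rfl⟩
    have r1 : (1 / τ) • (x i - x (i + 1)) - ContinuousLinearMap.adjoint V (y i)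
        - -(ContinuousLinearMap.adjoint V yh)
        = s • (a - a') - ContinuousLinearMap.adjoint V b := by
      rw [ha, ha', hb, hs, map_sub]; module
    have r2 : (1 / σ) • (y i - y (i + 1)) + A (x (i + 1) + ω • (x (i + 1) - x i)) - A xh
        = (1 / σ) • (b - b') + (V a' + ω • (V a' - V a) + (A - V) a' + ω • (A - V) (a' - a)) := by
      rw [ha, ha', hb, hb']
      simp only [map_sub, map_add, map_smul, ContinuousLinearMap.sub_apply]; module
    rw [r1, ← ha', inner_sub_left, inner_smul_left, three_point,
      ContinuousLinearMap.adjoint_inner_left] at e1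
    rw [r2, ← hb', inner_add_left, inner_smul_left, three_point] at e2
    simp only [inner_add_left, inner_sub_left, inner_smul_left] at e2
    simp only [conj_trivial] at e1 e2
    rw [← ha, ← ha', ← hb, ← hb']
    clear r1 r2
    have q1 := hStep (a' - a) (b' - b)
    simp only [map_sub, inner_sub_left, inner_sub_right] at q1
    have q2 := hD a' b'
    have q3 := hD (a' - a) b'
    rw [real_inner_comm] at e1
    have hσs : 1 / σ = ω * t := by rw [ht]; field_simp
    rw [hσs] at e2
    have g1 : (s / 2 + (γG - 1 / 2 * (M * ε) / ω)) * ω ≥ s / 2 := by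
      have z1 : γG - 1 / 2 * (M * ε) / ω ≥ μG := by
        have : ε / (2 * ω) * M = 1 / 2 * (M * ε) / ω := by field_simp
        linarith
      have z2 : (s / 2 + μG) * ω = s / 2 := by
        rw [hω, hs]; field_simp
      have z3 : (s / 2 + μG) * ω ≤ (s / 2 + (γG - 1 / 2 * (M * ε) / ω)) * ω :=
        mul_le_mul_of_nonneg_right (by linarith) hω0.le
      linarith
    have g2 : ω * t / 2 + (γF - (1 + ω) / 2 * (M / ε)) ≥ t / 2 := by
      have z1 : (1 + ω) / (2 * ε) * M = (1 + ω) / 2 * (M / ε) := by field_simp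
      have z2 : ω * t / 2 + μF = t / 2 := by
        have : μF = τ * μG / σ := by rw [← hσμ]; field_simp
        rw [ht, this, hω]; field_simp
      linarith
    have g1' : s * ω / 2 + ω * γG - 1 / 2 * (M * ε) ≥ s / 2 := by
      have : (s / 2 + (γG - 1 / 2 * (M * ε) / ω)) * ω = s * ω / 2 + ω * γG - 1 / 2 * (M * ε) := by
        field_simp
        ring
      linarith
    have f1 := mul_le_mul_of_nonneg_right g1' (sq_nonneg ‖a'‖)
    have f2 := mul_le_mul_of_nonneg_right g2 (sq_nonneg ‖b'‖)
    have f3 := mul_le_mul_of_nonneg_left q1 hω0.le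
    have f4 := mul_le_mul_of_nonneg_left q3 hω0.le
    have f5 := mul_le_mul_of_nonneg_left e1 hω0.le
    simp only [map_sub, inner_sub_left] at f4 e2
    linarith
  have hc : 0 < (1 - θ) / 2 * min s t := by
    have := lt_min hs0 ht0
    have : 0 < 1 - θ := by linarith
    positivity
  have hPN : ∀ N, P N ≤ P 0 * ω ^ N := by
    intro N
    induction N with
    | zero => simp
    | succ n ih =>
      calc P (n + 1) ≤ ω * P n := hrec n
        _ ≤ ω * (P 0 * ω ^ n) := by gcongr
        _ = _ := by ring
  refine ⟨P 0 / ((1 - θ) / 2 * min s t), ?_, ?_⟩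
  · apply div_nonneg _ hc.le
    exact le_trans (by positivity) (hPlow 0)
  · intro N
    rw [div_mul_eq_mul_div, le_div_iff₀ hc, mul_comm]
    exact (hPlow N).trans (hPN N)
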